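/- Let A and B be two real matrices of the same size, both of rank r. Then ‖AA† − BB†‖₂ ≤ ‖A − B‖₂/σ_r(A) and ‖A†A − B†B‖₂ ≤ ‖A − B‖₂/σ_r(A); moreover ‖AA† − BB†‖_F ≤ √2 ‖A − B‖_F/σ_r(A) and ‖A†A − B†B‖_F ≤ √2 ‖A − B‖_F/σ_r(A). -/

import Mathlib

open scoped BigOperators
open Matrix

noncomputable section

namespace TCUR

/-- Euclidean norm of a finite real vector. -/
def enorm {ι : Type*} [Fintype ι] (x : ι → ℝ) : ℝ :=
  Real.sqrt (∑ i, x i ^ 2)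

/-- Frobenius norm of a real matrix. -/
def frob {m n : Type*} [Fintype m] [Fintype n] (A : Matrix m n ℝ) : ℝ :=
  Real.sqrt (∑ i, ∑ j, A i j ^ 2)

/-- Spectral norm of a real matrix. -/
def spec {m n : Type*} [Fintype m] [Fintype n] (A : Matrix m n ℝ) : ℝ :=
  sSup ((fun x => enorm (A.mulVec x)) '' {x : n → ℝ | enorm x ≤ 1})

/-- The four Penrose conditions: `B` is the Moore–Penrose pseudoinverse of `A`. -/
def IsMP {m n : Type*} [Fintype m] [Fintype n] (A : Matrix m n ℝ) (B : Matrix n m ℝ) : Prop :=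
  A * B * A = A ∧ B * A * B = B ∧ (A * B)ᵀ = A * B ∧ (B * A)ᵀ = B * A

open Classical in
/-- Moore–Penrose pseudoinverse of a real matrix (def body). -/
def pinv {m n : Type*} [Fintype m] [Fintype n] (A : Matrix m n ℝ) : Matrix n m ℝ :=
  if h : ∃ B, IsMP A B then h.choose else 0

/-- `sval k A` is the `k`-th largest singular value of `A`
(via the Eckart–Young characterization). -/
def sval {m n : Type*} [Fintype m] [Fintype n] (k : ℕ) (A : Matrix m n ℝ) : ℝ :=
  sInf ((fun B => spec (A - B)) '' {B : Matrix m n ℝ | B.rank < k})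

/-- `IsBestRank r A Ar`: `Ar` is a best rank-`r` (Frobenius) approximation of `A`,
 e.g. a rank-`r` truncated SVD of `A`. -/
def IsBestRank {m n : Type*} [Fintype m] [Fintype n] (r : ℕ) (A Ar : Matrix m n ℝ) : Prop :=
  Ar.rank ≤ r ∧ ∀ B : Matrix m n ℝ, B.rank ≤ r → frob (A - Ar) ≤ frob (A - B)

/-- Compact SVD data: `A = W * S * Vᵀ` with `W, V` having orthonormal columns and
`S` diagonal with positive diagonal entries. -/
def CompactSVD {m n : Type*} [Fintype m] [Fintype n] {r : ℕ} (A : Matrix m n ℝ)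
    (W : Matrix m (Fin r) ℝ) (S : Matrix (Fin r) (Fin r) ℝ) (V : Matrix n (Fin r) ℝ) : Prop :=
  A = W * S * Vᵀ ∧ Wᵀ * W = 1 ∧ Vᵀ * V = 1 ∧ (∀ i j, i ≠ j → S i j = 0) ∧ ∀ i, 0 < S i i

/-- Coherence `μ(W) = (d/r) max_i ‖W(i,:)‖₂²` of a matrix with orthonormal columns. -/
def coh {m r : Type*} [Fintype m] [Fintype r] (W : Matrix m r ℝ) : ℝ :=
  ((Fintype.card m : ℝ) / (Fintype.card r : ℝ)) * ⨆ i : m, ∑ j, W i j ^ 2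

/-- Row submatrix with rows restricted to `I`. -/
def rowsub {m k : Type*} (M : Matrix m k ℝ) (I : Finset m) : Matrix {x // x ∈ I} k ℝ :=
  M.submatrix Subtype.val id

/-- Probability, with respect to the uniform distribution on the finite sample space
`{ω : Ω | cond ω}`, of the event `{ω | event ω}`. -/
def uniformProb {Ω : Type*} [Fintype Ω] (cond event : Ω → Prop) : ℝ :=
  (Nat.card {ω : Ω // cond ω ∧ event ω} : ℝ) / (Nat.card {ω : Ω // cond ω} : ℝ)

variable {n : ℕ}

/-- Mode-`k` unfolding of an `n`-mode tensor: the matrix whose columns are the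
mode-`k` fibers of the tensor. -/
def unfold {ι : Fin n → Type*} (A : ((i : Fin n) → ι i) → ℝ) (k : Fin n) :
    Matrix (ι k) ((j : {j : Fin n // j ≠ k}) → ι j.1) ℝ :=
  fun x y => A fun i => if h : i = k then cast (congrArg ι h.symm) x else y ⟨i, h⟩

/-- Tucker (all-modes) product `T ×₁ M 1 ×₂ ⋯ ×ₙ M n`. -/
def tucker {ι κ : Fin n → Type*} [∀ i, Fintype (κ i)]
    (T : ((i : Fin n) → κ i) → ℝ) (M : (i : Fin n) → Matrix (ι i) (κ i) ℝ) :
    ((i : Fin n) → ι i) → ℝ :=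
  fun x => ∑ y : (i : Fin n) → κ i, (∏ i, M i (x i) (y i)) * T y

/-- The subtensor with mode-`i` indices restricted to `I i`. -/
def subT {ι : Fin n → Type*} (A : ((i : Fin n) → ι i) → ℝ)
    (I : (i : Fin n) → Finset (ι i)) : ((i : Fin n) → {x // x ∈ I i}) → ℝ :=
  fun x => A fun i => (x i).1

/-- Frobenius norm of a tensor. -/
def tfrob {ι : Fin n → Type*} [∀ i, Fintype (ι i)] (A : ((i : Fin n) → ι i) → ℝ) : ℝ :=
  Real.sqrt (∑ x : (i : Fin n) → ι i, A x ^ 2)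

/-- `Cmat A J i = 𝒜_(i)(:,J_i)`: the mode-`i` unfolding restricted to the columns `J i`. -/
def Cmat {ι : Fin n → Type*} (A : ((i : Fin n) → ι i) → ℝ)
    (J : (i : Fin n) → Finset ((j : {j : Fin n // j ≠ i}) → ι j.1)) (i : Fin n) :
    Matrix (ι i) {y // y ∈ J i} ℝ :=
  (unfold A i).submatrix id Subtype.val

/-- `Umat A I J i = 𝒜_(i)(I_i,J_i)`. -/
def Umat {ι : Fin n → Type*} (A : ((i : Fin n) → ι i) → ℝ)
    (I : (i : Fin n) → Finset (ι i))
    (J : (i : Fin n) → Finset ((j : {j : Fin n // j ≠ i}) → ι j.1)) (i : Fin n) :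
    Matrix {x // x ∈ I i} {y // y ∈ J i} ℝ :=
  (unfold A i).submatrix Subtype.val Subtype.val

/-- The Chidori column index set `⊗_{j ≠ i} I j`. -/
def chidoriJ {ι : Fin n → Type*} (I : (i : Fin n) → Finset (ι i)) (i : Fin n) :
    Finset ((j : {j : Fin n // j ≠ i}) → ι j.1) :=
  Fintype.piFinset fun j => I j.1

/-- `σ_max(𝒜) = max_j σ₁(𝒜_(j))`. -/
def tsmax {ι : Fin n → Type*} [∀ i, Fintype (ι i)] (A : ((i : Fin n) → ι i) → ℝ) : ℝ :=
  ⨆ j, sval 1 (unfold A j)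

/-- `σ_min(𝒜) = min_j σ_{r_j}(𝒜_(j))`. -/
def tsmin {ι : Fin n → Type*} [∀ i, Fintype (ι i)] (A : ((i : Fin n) → ι i) → ℝ)
    (r : Fin n → ℕ) : ℝ :=
  ⨅ j, sval (r j) (unfold A j)


section VectorNorm

variable {ι : Type*} [Fintype ι]

lemma enorm_nonneg (x : ι → ℝ) : 0 ≤ enorm x := Real.sqrt_nonneg _

lemma enorm_sq (x : ι → ℝ) : enorm x ^ 2 = x ⬝ᵥ x := by
  rw [enorm, Real.sq_sqrt (Finset.sum_nonneg fun i _ => sq_nonneg _)]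
  simp [dotProduct, sq]

lemma enorm_smul (c : ℝ) (x : ι → ℝ) : enorm (c • x) = |c| * enorm x := by
  rw [← sq_eq_sq₀ (enorm_nonneg _) (mul_nonneg (abs_nonneg _) (enorm_nonneg _)), mul_pow,
    enorm_sq, enorm_sq, sq_abs, smul_dotProduct, dotProduct_smul]
  simp only [smul_eq_mul]
  ring

lemma dotProduct_le_enorm_mul_enorm (x y : ι → ℝ) : x ⬝ᵥ y ≤ enorm x * enorm y :=
  Real.sum_mul_le_sqrt_mul_sqrt _ _ _

lemma enorm_eq_zero {x : ι → ℝ} : enorm x = 0 ↔ x = 0 := by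
  rw [← sq_eq_zero_iff, enorm_sq, dotProduct_self_eq_zero]

lemma enorm_le_iff {x : ι → ℝ} {c : ℝ} (hc : 0 ≤ c) : enorm x ≤ c ↔ x ⬝ᵥ x ≤ c ^ 2 := by
  rw [← enorm_sq, sq_le_sq₀ (enorm_nonneg _) hc]

lemma le_of_sq_le_mul {a c : ℝ} (hc : 0 ≤ c) (h : a ^ 2 ≤ c * a) : a ≤ c := by
  by_contra! hlt
  nlinarith

end VectorNorm

section MatrixNorm

variable {m n p : Type*} [Fintype m] [Fintype n] [Fintype p]

lemma frob_nonneg (A : Matrix m n ℝ) : 0 ≤ frob A := Real.sqrt_nonneg _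

lemma frob_sq_eq_sum (A : Matrix m n ℝ) : frob A ^ 2 = ∑ i, enorm (A i) ^ 2 := by
  refine (Real.sq_sqrt
    (Finset.sum_nonneg fun i _ => Finset.sum_nonneg fun j _ => sq_nonneg _)).trans ?_
  refine Finset.sum_congr rfl fun i _ => ?_
  rw [enorm, Real.sq_sqrt (Finset.sum_nonneg fun j _ => sq_nonneg _)]

lemma frob_sq_eq_trace (A : Matrix m n ℝ) : frob A ^ 2 = (A * Aᵀ).trace := by
  rw [frob_sq_eq_sum]
  refine Finset.sum_congr rfl fun i _ => ?_
  rw [enorm_sq]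
  rfl

lemma frob_transpose (A : Matrix m n ℝ) : frob Aᵀ = frob A := by
  rw [← sq_eq_sq₀ (frob_nonneg _) (frob_nonneg _), frob_sq_eq_trace, frob_sq_eq_trace,
    transpose_transpose, trace_mul_comm]

lemma enorm_mulVec_le_frob (A : Matrix m n ℝ) (x : n → ℝ) :
    enorm (A *ᵥ x) ≤ frob A * enorm x := by
  rw [enorm_le_iff (mul_nonneg (frob_nonneg _) (enorm_nonneg _)), mul_pow, frob_sq_eq_sum,
    Finset.sum_mul]
  refine Finset.sum_le_sum fun i _ => ?_
  rw [← mul_pow, ← sq]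
  refine sq_le_sq.2 (abs_le_abs (dotProduct_le_enorm_mul_enorm _ _) ?_)
  have := dotProduct_le_enorm_mul_enorm (-(A i)) x
  rwa [neg_dotProduct, ← neg_one_smul ℝ (A i), enorm_smul, abs_neg, abs_one, one_mul] at this

lemma enorm_mulVec_le (A : Matrix m n ℝ) (x : n → ℝ) : enorm (A *ᵥ x) ≤ spec A * enorm x := by
  rcases (enorm_nonneg x).eq_or_lt with h0 | h0
  · have hx : x = 0 := enorm_eq_zero.1 h0.symm
    simp [hx, enorm]
  have hb : BddAbove ((fun x => enorm (A.mulVec x)) '' {x : n → ℝ | enorm x ≤ 1}) := by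
    refine ⟨frob A, ?_⟩
    rintro _ ⟨y, hy, rfl⟩
    exact (enorm_mulVec_le_frob A y).trans (mul_le_of_le_one_right (frob_nonneg _) hy)
  have h1 : enorm (A *ᵥ ((enorm x)⁻¹ • x)) ≤ spec A := by
    refine le_csSup hb ⟨_, ?_, rfl⟩
    simp only [Set.mem_ofPred_eq]
    rw [enorm_smul, abs_of_pos (inv_pos.2 h0), inv_mul_cancel₀ h0.ne']
  rw [mulVec_smul, enorm_smul, abs_of_pos (inv_pos.2 h0), inv_mul_eq_div, div_le_iff₀ h0] at h1
  exact h1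

lemma spec_le {A : Matrix m n ℝ} {c : ℝ} (hc : 0 ≤ c)
    (h : ∀ x, enorm (A *ᵥ x) ≤ c * enorm x) : spec A ≤ c := by
  refine csSup_le ⟨_, 0, by simp [enorm], rfl⟩ ?_
  rintro _ ⟨y, hy, rfl⟩
  exact (h y).trans (mul_le_of_le_one_right hc hy)

lemma spec_nonneg (A : Matrix m n ℝ) : 0 ≤ spec A := by
  refine Real.sSup_nonneg ?_
  rintro _ ⟨y, -, rfl⟩
  exact enorm_nonneg _

lemma mulVec_dotProduct_eq (A : Matrix m n ℝ) (x : n → ℝ) (y : m → ℝ) :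
    (A *ᵥ x) ⬝ᵥ y = x ⬝ᵥ (Aᵀ *ᵥ y) := by
  rw [dotProduct_comm, dotProduct_mulVec, ← mulVec_transpose, dotProduct_comm]

lemma spec_transpose_le (A : Matrix m n ℝ) : spec Aᵀ ≤ spec A := by
  refine spec_le (spec_nonneg _) fun x => ?_
  refine le_of_sq_le_mul (mul_nonneg (spec_nonneg _) (enorm_nonneg _)) ?_
  rw [enorm_sq, mulVec_dotProduct_eq, transpose_transpose]
  calc _ ≤ enorm x * enorm (A *ᵥ (Aᵀ *ᵥ x)) := dotProduct_le_enorm_mul_enorm _ _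
    _ ≤ enorm x * (spec A * enorm (Aᵀ *ᵥ x)) :=
      mul_le_mul_of_nonneg_left (enorm_mulVec_le _ _) (enorm_nonneg _)
    _ = _ := by ring

lemma spec_transpose (A : Matrix m n ℝ) : spec Aᵀ = spec A :=
  le_antisymm (spec_transpose_le A) (by simpa using spec_transpose_le Aᵀ)

lemma spec_mul_le (A : Matrix m n ℝ) (B : Matrix n p ℝ) : spec (A * B) ≤ spec A * spec B := by
  refine spec_le (mul_nonneg (spec_nonneg _) (spec_nonneg _)) fun x => ?_
  rw [← mulVec_mulVec, mul_assoc]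
  exact (enorm_mulVec_le _ _).trans
    (mul_le_mul_of_nonneg_left (enorm_mulVec_le _ _) (spec_nonneg _))

lemma frob_mul_le (A : Matrix m n ℝ) (B : Matrix n p ℝ) : frob (A * B) ≤ frob A * spec B := by
  rw [← sq_le_sq₀ (frob_nonneg _) (mul_nonneg (frob_nonneg _) (spec_nonneg _)), mul_pow,
    frob_sq_eq_sum, frob_sq_eq_sum, Finset.sum_mul]
  refine Finset.sum_le_sum fun i _ => ?_
  have h : (A * B) i = Bᵀ *ᵥ A i := by
    rw [mulVec_transpose]
    rfl
  rw [h, ← mul_pow, mul_comm, ← spec_transpose]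
  exact pow_le_pow_left₀ (enorm_nonneg _) (enorm_mulVec_le _ _) 2

lemma frob_mul_le' (A : Matrix m n ℝ) (B : Matrix n p ℝ) : frob (A * B) ≤ spec A * frob B := by
  rw [← frob_transpose, transpose_mul, mul_comm (spec A), ← frob_transpose B, ← spec_transpose A]
  exact frob_mul_le _ _

end MatrixNorm

section Pseudoinverse

variable {m n : Type*} [Fintype m] [Fintype n]

lemma exists_isMP (A : Matrix m n ℝ) : ∃ B, IsMP A B := by
  classical
  have hH : (Aᵀ * A).IsHermitian := by
    simpa using isHermitian_conjTranspose_mul_self A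
  obtain ⟨G, hGt, hcomm, hHGH, hGHG⟩ : ∃ G : Matrix n n ℝ, Gᵀ = G ∧
      G * (Aᵀ * A) = (Aᵀ * A) * G ∧ (Aᵀ * A) * G * (Aᵀ * A) = Aᵀ * A ∧
      G * (Aᵀ * A) * G = G := by
    let U := hH.eigenvectorUnitary
    let φ := Unitary.conjStarAlgAut ℝ (Matrix n n ℝ) U
    let d := hH.eigenvalues
    have hs : Aᵀ * A = φ (diagonal d) := hH.spectral_theorem
    have key : ∀ a b : ℝ, b = a⁻¹ → a * b * a = a ∧ b * a * b = b := by
      rintro a _ rfl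
      constructor
      · exact mul_inv_mul_cancel a
      · simpa using mul_inv_mul_cancel a⁻¹
    refine ⟨φ (diagonal fun i => (d i)⁻¹), ?_, ?_, ?_, ?_⟩
    · rw [← conjTranspose_eq_transpose_of_trivial, ← star_eq_conjTranspose, ← map_star,
        star_eq_conjTranspose, diagonal_conjTranspose]
      simp
    · rw [hs, ← map_mul, ← map_mul, diagonal_mul_diagonal, diagonal_mul_diagonal]
      simp [mul_comm]
    · rw [hs, ← map_mul, ← map_mul, diagonal_mul_diagonal, diagonal_mul_diagonal]
      simp [fun i => (key (d i) _ rfl).1]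
    · rw [hs, ← map_mul, ← map_mul, diagonal_mul_diagonal, diagonal_mul_diagonal]
      simp [fun i => (key (d i) _ rfl).2]
  have hAGH : A * G * (Aᵀ * A) = A := by
    rw [← sub_eq_zero, ← conjTranspose_mul_self_eq_zero]
    simp only [conjTranspose_eq_transpose_of_trivial, transpose_sub, transpose_mul,
      transpose_transpose, hGt]
    calc _ = (Aᵀ * A) * G * (Aᵀ * A) * (G * (Aᵀ * A)) - (Aᵀ * A) * G * (Aᵀ * A)
          - ((Aᵀ * A) * G * (Aᵀ * A) - Aᵀ * A) := by
          simp only [Matrix.mul_sub, Matrix.sub_mul, Matrix.mul_assoc]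
      _ = (Aᵀ * A) * G * (Aᵀ * A) - (Aᵀ * A) * G * (Aᵀ * A)
          - ((Aᵀ * A) * G * (Aᵀ * A) - Aᵀ * A) := by rw [hHGH, ← Matrix.mul_assoc, hHGH]
      _ = 0 := by rw [hHGH]; simp
  refine ⟨G * Aᵀ, ?_, ?_, ?_, ?_⟩
  · simpa only [Matrix.mul_assoc] using hAGH
  · rw [Matrix.mul_assoc G, ← Matrix.mul_assoc, hGHG]
  · simp only [transpose_mul, transpose_transpose, hGt, Matrix.mul_assoc]
  · rw [Matrix.mul_assoc, transpose_mul, hGt, transpose_mul, transpose_transpose, hcomm]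

lemma isMP_pinv (A : Matrix m n ℝ) : IsMP A (pinv A) := by
  have h := exists_isMP A
  rw [pinv, dif_pos h]
  exact h.choose_spec

lemma IsMP.transpose {A : Matrix m n ℝ} {X : Matrix n m ℝ} (h : IsMP A X) : IsMP Aᵀ Xᵀ := by
  obtain ⟨h1, h2, h3, h4⟩ := h
  refine ⟨?_, ?_, ?_, ?_⟩
  · rw [← transpose_mul, ← transpose_mul, ← Matrix.mul_assoc, h1]
  · rw [← transpose_mul, ← transpose_mul, ← Matrix.mul_assoc, h2]
  · rw [← transpose_mul, h4, h4]
  · rw [← transpose_mul, h3, h3]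

lemma IsMP.rank_mul {A : Matrix m n ℝ} {X : Matrix n m ℝ} (h : IsMP A X) :
    (A * X).rank = A.rank := by
  refine le_antisymm (rank_mul_le_left _ _) ?_
  conv_lhs => rw [← h.1]
  exact rank_mul_le_left _ _

end Pseudoinverse

section SingularValue

variable {m n : Type*} [Fintype n]

lemma rank_add_finrank_ker (A : Matrix m n ℝ) :
    A.rank + Module.finrank ℝ (LinearMap.ker A.mulVecLin) = Module.finrank ℝ (n → ℝ) :=
  LinearMap.finrank_range_add_finrank_ker _

lemma eq_zero_of_rank_eq_zero {A : Matrix m n ℝ} (hA : A.rank = 0) : A = 0 := by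
  classical
  have h : LinearMap.ker A.mulVecLin = ⊤ := by
    refine Submodule.eq_top_of_finrank_eq ?_
    rw [← rank_add_finrank_ker A, hA, zero_add]
  refine ext_of_mulVec_single fun i => ?_
  rw [zero_mulVec]
  exact LinearMap.congr_fun (LinearMap.ker_eq_top.1 h) (Pi.single i 1)

variable [Fintype m]

lemma sval_le_spec_sub (A C : Matrix m n ℝ) {r : ℕ} (hC : C.rank < r) :
    sval r A ≤ spec (A - C) := by
  refine csInf_le ⟨0, ?_⟩ ⟨C, hC, rfl⟩
  rintro _ ⟨D, -, rfl⟩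
  exact spec_nonneg _

/-- On the row space of `A`, the matrix `A` expands norms by at least its smallest positive
singular value. -/
lemma sval_rank_mul_enorm_le (A : Matrix m n ℝ) (w : m → ℝ) :
    sval A.rank A * enorm (Aᵀ *ᵥ w) ≤ enorm (A *ᵥ (Aᵀ *ᵥ w)) := by
  set y := Aᵀ *ᵥ w with hy
  rcases (enorm_nonneg y).eq_or_lt with h0 | h0
  · rw [← h0, mul_zero]
    exact enorm_nonneg _
  have hyy : y ⬝ᵥ y = enorm y ^ 2 := (enorm_sq y).symm
  have hyne : y ⬝ᵥ y ≠ 0 := by rw [hyy]; positivity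
  let D : Matrix m n ℝ := vecMulVec ((y ⬝ᵥ y)⁻¹ • (A *ᵥ y)) y
  have hD : ∀ x, D *ᵥ x = ((y ⬝ᵥ y)⁻¹ * (y ⬝ᵥ x)) • (A *ᵥ y) := by
    intro x
    rw [vecMulVec_mulVec]
    ext i
    simp
    ring
  have hker : ∀ x, A *ᵥ x = 0 → y ⬝ᵥ x = 0 := by
    intro x hx
    rw [hy, mulVec_dotProduct_eq, transpose_transpose, hx, dotProduct_zero]
  have hlt : LinearMap.ker A.mulVecLin < LinearMap.ker (A - D).mulVecLin := by
    refine lt_of_le_of_ne (fun x hx => ?_) fun he => ?_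
    · have hx' : A *ᵥ x = 0 := hx
      change (A - D) *ᵥ x = 0
      rw [sub_mulVec, hD, hx', hker x hx']
      simp
    · have hmem : y ∈ LinearMap.ker (A - D).mulVecLin := by
        change (A - D) *ᵥ y = 0
        rw [sub_mulVec, hD, inv_mul_cancel₀ hyne, one_smul, sub_self]
      rw [← he] at hmem
      exact hyne (hker y hmem)
  have hrank : (A - D).rank < A.rank := by
    have h1 := rank_add_finrank_ker A
    have h2 := rank_add_finrank_ker (A - D)
    have h3 := Submodule.finrank_lt_finrank_of_lt hlt
    omega
  have hs := sval_le_spec_sub A (A - D) hrank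
  rw [sub_sub_cancel] at hs
  have hDs : spec D ≤ (enorm y)⁻¹ * enorm (A *ᵥ y) := by
    refine spec_le (mul_nonneg (inv_nonneg.2 h0.le) (enorm_nonneg _)) fun x => ?_
    rw [hD, enorm_smul, abs_mul, abs_inv, hyy, abs_of_pos (pow_pos h0 2)]
    have hcs : |y ⬝ᵥ x| ≤ enorm y * enorm x := by
      refine abs_le.2 ⟨?_, dotProduct_le_enorm_mul_enorm _ _⟩
      have := dotProduct_le_enorm_mul_enorm ((-1 : ℝ) • y) x
      rw [enorm_smul, smul_dotProduct, abs_neg, abs_one, one_mul, smul_eq_mul] at this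
      linarith
    calc _ ≤ (enorm y ^ 2)⁻¹ * (enorm y * enorm x) * enorm (A *ᵥ y) := by
          gcongr
          exact enorm_nonneg _
      _ = _ := by field_simp
  calc _ ≤ (enorm y)⁻¹ * enorm (A *ᵥ y) * enorm y := by
        gcongr
        exact hs.trans hDs
    _ = _ := by field_simp

lemma IsMP.one_le_spec_mul {A C : Matrix m n ℝ} {X : Matrix n m ℝ} (h : IsMP A X)
    (hC : C.rank < A.rank) : 1 ≤ spec X * spec (A - C) := by
  obtain ⟨h1, h2, h3, h4⟩ := h
  have hrk : (X * A).rank = A.rank := by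
    refine le_antisymm (rank_mul_le_right _ _) ?_
    conv_lhs => rw [← h1, Matrix.mul_assoc]
    exact rank_mul_le_right _ _
  have hnd : ¬ Disjoint (LinearMap.ker C.mulVecLin) (LinearMap.range (X * A).mulVecLin) := by
    intro hd
    have h5 := Submodule.finrank_add_finrank_le_of_disjoint hd
    have h6 := rank_add_finrank_ker C
    have h7 : Module.finrank ℝ (LinearMap.range (X * A).mulVecLin) = A.rank := hrk
    omega
  obtain ⟨y, hyC, ⟨u, rfl⟩, hy0⟩ : ∃ y, y ∈ LinearMap.ker C.mulVecLin ∧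
      y ∈ LinearMap.range (X * A).mulVecLin ∧ y ≠ 0 := by
    by_contra! hcon
    exact hnd (Submodule.disjoint_def.2 hcon)
  rw [mulVecLin_apply] at hyC hy0
  set y := (X * A) *ᵥ u
  have hC0 : C *ᵥ y = 0 := hyC
  have hXA : X *ᵥ ((A - C) *ᵥ y) = y := by
    rw [sub_mulVec, hC0, sub_zero, mulVec_mulVec, mulVec_mulVec, ← Matrix.mul_assoc, h2]
  have hpos : 0 < enorm y :=
    (enorm_nonneg y).lt_of_ne fun he => hy0 (enorm_eq_zero.1 he.symm)
  have := calc enorm y = enorm (X *ᵥ ((A - C) *ᵥ y)) := by rw [hXA]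
    _ ≤ spec X * (spec (A - C) * enorm y) := (enorm_mulVec_le _ _).trans
      (mul_le_mul_of_nonneg_left (enorm_mulVec_le _ _) (spec_nonneg _))
  rw [← mul_assoc] at this
  exact (le_mul_iff_one_le_left hpos).1 this

lemma sval_rank_pos {A : Matrix m n ℝ} (hA : 0 < A.rank) : 0 < sval A.rank A := by
  have hX := spec_nonneg (pinv A)
  refine lt_of_lt_of_le (inv_pos.2 (by linarith : 0 < spec (pinv A) + 1)) ?_
  refine le_csInf ⟨_, 0, by simpa using hA, rfl⟩ ?_
  rintro _ ⟨C, hC, rfl⟩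
  have h1 := (isMP_pinv A).one_le_spec_mul hC
  have h2 := spec_nonneg (A - C)
  rw [inv_le_iff_one_le_mul₀ (by linarith)]
  nlinarith

lemma spec_pinv_le {A : Matrix m n ℝ} (hA : 0 < A.rank) : spec (pinv A) ≤ (sval A.rank A)⁻¹ := by
  have hσ := sval_rank_pos hA
  obtain ⟨h1, h2, h3, h4⟩ := isMP_pinv A
  set X := pinv A
  refine spec_le (inv_nonneg.2 hσ.le) fun u => ?_
  have hX : Aᵀ *ᵥ (Xᵀ *ᵥ (X *ᵥ u)) = X *ᵥ u := by
    rw [mulVec_mulVec, mulVec_mulVec, ← transpose_mul, h4, h2]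
  have h5 := sval_rank_mul_enorm_le A (Xᵀ *ᵥ (X *ᵥ u))
  rw [hX] at h5
  have h6 : enorm (A *ᵥ (X *ᵥ u)) ≤ enorm u := by
    refine le_of_sq_le_mul (enorm_nonneg _) ?_
    rw [enorm_sq, mulVec_mulVec, mulVec_dotProduct_eq, h3, mulVec_mulVec, ← Matrix.mul_assoc, h1]
    exact dotProduct_le_enorm_mul_enorm _ _
  rw [inv_mul_eq_div, le_div_iff₀ hσ, mul_comm]
  exact h5.trans h6

end SingularValue

section Projection

variable {m : Type*} [Fintype m]

/-- A matrix is an orthogonal projection if it is idempotent and symmetric. -/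
def IsOrthProj (P : Matrix m m ℝ) : Prop := P * P = P ∧ Pᵀ = P

variable {P Q : Matrix m m ℝ}

lemma IsOrthProj.dotProduct_mulVec (hP : IsOrthProj P) (x y : m → ℝ) :
    (P *ᵥ x) ⬝ᵥ y = x ⬝ᵥ (P *ᵥ y) := by
  rw [mulVec_dotProduct_eq, hP.2]

lemma IsOrthProj.mulVec_mulVec_self (hP : IsOrthProj P) (x : m → ℝ) :
    P *ᵥ (P *ᵥ x) = P *ᵥ x := by
  rw [mulVec_mulVec, hP.1]

lemma IsOrthProj.mulVec_dotProduct_mulVec (hP : IsOrthProj P) (x : m → ℝ) :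
    (P *ᵥ x) ⬝ᵥ (P *ᵥ x) = x ⬝ᵥ (P *ᵥ x) := by
  rw [hP.dotProduct_mulVec, hP.mulVec_mulVec_self]

lemma IsOrthProj.enorm_sub_sq (hP : IsOrthProj P) (x : m → ℝ) :
    enorm (x - P *ᵥ x) ^ 2 = enorm x ^ 2 - enorm (P *ᵥ x) ^ 2 := by
  simp only [enorm_sq, sub_dotProduct, dotProduct_sub, hP.mulVec_dotProduct_mulVec,
    dotProduct_comm (P *ᵥ x) x]
  ring

/-- For orthogonal projections of equal rank, the one-sided gap between the ranges is
symmetric. -/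
lemma IsOrthProj.enorm_sub_le_of_rank_eq (hP : IsOrthProj P) (hQ : IsOrthProj Q)
    (hr : P.rank = Q.rank) {s : ℝ} (hs : 0 ≤ s)
    (h : ∀ u, enorm (P *ᵥ u - Q *ᵥ (P *ᵥ u)) ≤ s * enorm (P *ᵥ u)) (v : m → ℝ) :
    enorm (Q *ᵥ v - P *ᵥ (Q *ᵥ v)) ≤ s * enorm (Q *ᵥ v) := by
  rw [← sq_le_sq₀ (enorm_nonneg _) (mul_nonneg hs (enorm_nonneg _)), mul_pow, hP.enorm_sub_sq]
  have h' : ∀ u, (1 - s ^ 2) * enorm (P *ᵥ u) ^ 2 ≤ enorm (Q *ᵥ (P *ᵥ u)) ^ 2 := by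
    intro u
    have := h u
    rw [← sq_le_sq₀ (enorm_nonneg _) (mul_nonneg hs (enorm_nonneg _)), mul_pow,
      hQ.enorm_sub_sq] at this
    linarith
  rcases le_or_gt 1 s with h1 | h1
  · have hs1 : 1 ≤ s ^ 2 := one_le_pow₀ h1
    have hmul := le_mul_of_one_le_left (sq_nonneg (enorm (Q *ᵥ v))) hs1
    linarith [sq_nonneg (enorm (P *ᵥ (Q *ᵥ v)))]
  have hs1 : 0 < 1 - s ^ 2 := by nlinarith
  have hker : LinearMap.ker (Q * P).mulVecLin = LinearMap.ker P.mulVecLin := by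
    ext x
    simp only [LinearMap.mem_ker, mulVecLin_apply, ← mulVec_mulVec]
    refine ⟨fun hx => ?_, fun hx => by rw [hx, mulVec_zero]⟩
    have := h' x
    rw [hx, enorm_eq_zero.2 rfl] at this
    refine enorm_eq_zero.1 (pow_eq_zero_iff two_ne_zero |>.1 ?_)
    nlinarith [sq_nonneg (enorm (P *ᵥ x))]
  have hrange : LinearMap.range (Q * P).mulVecLin = LinearMap.range Q.mulVecLin := by
    refine Submodule.eq_of_le_of_finrank_eq ?_ ?_
    · rw [mulVecLin_mul]
      exact LinearMap.range_comp_le_range _ _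
    · have h2 := rank_add_finrank_ker (Q * P)
      have h3 := rank_add_finrank_ker P
      rw [hker] at h2
      change (Q * P).rank = Q.rank
      omega
  obtain ⟨w, hw⟩ : Q *ᵥ v ∈ LinearMap.range (Q * P).mulVecLin := by
    rw [hrange]
    exact ⟨v, rfl⟩
  rw [mulVecLin_apply, ← mulVec_mulVec] at hw
  have hzy := h' w
  rw [hw] at hzy
  have hcs : enorm (Q *ᵥ v) ^ 2 ≤ enorm (P *ᵥ (Q *ᵥ v)) * enorm (P *ᵥ w) := by
    refine le_trans (le_of_eq ?_) (dotProduct_le_enorm_mul_enorm _ _)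
    rw [enorm_sq, ← hw, hP.dotProduct_mulVec, hP.mulVec_mulVec_self, hQ.dotProduct_mulVec,
      hQ.dotProduct_mulVec, hQ.mulVec_mulVec_self]
  rcases (enorm_nonneg (Q *ᵥ v)).eq_or_lt with h0 | h0
  · rw [← h0]
    nlinarith [sq_nonneg (enorm (P *ᵥ (Q *ᵥ v)))]
  have hz2 := pow_pos h0 2
  have hcs2 := pow_le_pow_left₀ hz2.le hcs 2
  rw [mul_pow] at hcs2
  suffices (1 - s ^ 2) * enorm (Q *ᵥ v) ^ 2 ≤ enorm (P *ᵥ (Q *ᵥ v)) ^ 2 by linarith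
  refine le_of_mul_le_mul_right ?_ hz2
  calc _ = (1 - s ^ 2) * (enorm (Q *ᵥ v) ^ 2) ^ 2 := by ring
    _ ≤ (1 - s ^ 2) * (enorm (P *ᵥ (Q *ᵥ v)) ^ 2 * enorm (P *ᵥ w) ^ 2) := by gcongr
    _ = enorm (P *ᵥ (Q *ᵥ v)) ^ 2 * ((1 - s ^ 2) * enorm (P *ᵥ w) ^ 2) := by ring
    _ ≤ _ := by gcongr

lemma IsOrthProj.spec_sub_le (hP : IsOrthProj P) (hQ : IsOrthProj Q) (hr : P.rank = Q.rank) :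
    spec (P - Q) ≤ spec (P - Q * P) := by
  set s := spec (P - Q * P) with hs
  have hs0 : 0 ≤ s := spec_nonneg _
  have h : ∀ u, enorm (P *ᵥ u - Q *ᵥ (P *ᵥ u)) ≤ s * enorm (P *ᵥ u) := by
    intro u
    have := enorm_mulVec_le (P - Q * P) (P *ᵥ u)
    rwa [sub_mulVec, ← mulVec_mulVec, hP.mulVec_mulVec_self] at this
  have h' := hP.enorm_sub_le_of_rank_eq hQ hr hs0 h
  have hQP : spec (Q - Q * P) ≤ s := by
    have ht : (Q - P * Q)ᵀ = Q - Q * P := by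
      rw [transpose_sub, transpose_mul, hP.2, hQ.2]
    rw [← ht, spec_transpose]
    refine spec_le hs0 fun v => ?_
    rw [sub_mulVec, ← mulVec_mulVec]
    refine (h' v).trans (mul_le_mul_of_nonneg_left ?_ hs0)
    refine le_of_sq_le_mul (enorm_nonneg _) ?_
    rw [enorm_sq, hQ.mulVec_dotProduct_mulVec]
    exact dotProduct_le_enorm_mul_enorm _ _
  refine spec_le hs0 fun u => ?_
  have h2 : enorm (Q *ᵥ (u - P *ᵥ u)) ≤ s * enorm (u - P *ᵥ u) := by
    have h3 := enorm_mulVec_le (Q - Q * P) (u - P *ᵥ u)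
    rw [sub_mulVec, ← mulVec_mulVec, mulVec_sub P, hP.mulVec_mulVec_self, sub_self, mulVec_zero,
      sub_zero] at h3
    exact h3.trans (mul_le_mul_of_nonneg_right hQP (enorm_nonneg _))
  have hdecomp : (P - Q) *ᵥ u = (P *ᵥ u - Q *ᵥ (P *ᵥ u)) - Q *ᵥ (u - P *ᵥ u) := by
    rw [sub_mulVec, mulVec_sub]
    abel
  have horth : (P *ᵥ u - Q *ᵥ (P *ᵥ u)) ⬝ᵥ (Q *ᵥ (u - P *ᵥ u)) = 0 := by
    rw [← hQ.dotProduct_mulVec, mulVec_sub, hQ.mulVec_mulVec_self, sub_self, zero_dotProduct]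
  have hpyth : enorm ((P - Q) *ᵥ u) ^ 2
      = enorm (P *ᵥ u - Q *ᵥ (P *ᵥ u)) ^ 2 + enorm (Q *ᵥ (u - P *ᵥ u)) ^ 2 := by
    rw [hdecomp]
    generalize P *ᵥ u - Q *ᵥ (P *ᵥ u) = a at horth
    generalize Q *ᵥ (u - P *ᵥ u) = b at horth
    rw [enorm_sq, enorm_sq, enorm_sq, sub_dotProduct, dotProduct_sub, dotProduct_sub,
      dotProduct_comm b a, horth]
    ring
  rw [← sq_le_sq₀ (enorm_nonneg _) (mul_nonneg hs0 (enorm_nonneg _)), hpyth]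
  have h4 := pow_le_pow_left₀ (enorm_nonneg _) (h u) 2
  have h5 := pow_le_pow_left₀ (enorm_nonneg _) h2 2
  rw [mul_pow] at h4 h5 ⊢
  rw [hP.enorm_sub_sq] at h5
  linarith

lemma IsOrthProj.trace_eq_rank (hP : IsOrthProj P) : P.trace = P.rank := by
  classical
  have hproj : LinearMap.IsProj (LinearMap.range P.mulVecLin) P.mulVecLin := by
    refine ⟨fun x => ⟨x, rfl⟩, ?_⟩
    rintro _ ⟨x, rfl⟩
    exact hP.mulVec_mulVec_self x
  have h := hproj.trace
  rw [← toLin'_apply', trace_toLin'_eq] at h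
  exact h

lemma IsOrthProj.frob_sub (hP : IsOrthProj P) (hQ : IsOrthProj Q) (hr : P.rank = Q.rank) :
    frob (P - Q) = Real.sqrt 2 * frob (P - Q * P) := by
  rw [← sq_eq_sq₀ (frob_nonneg _) (mul_nonneg (Real.sqrt_nonneg _) (frob_nonneg _)), mul_pow,
    Real.sq_sqrt zero_le_two, frob_sq_eq_trace, frob_sq_eq_trace]
  have h1 : (P - Q) * (P - Q)ᵀ = P + Q - P * Q - Q * P := by
    rw [transpose_sub, hP.2, hQ.2]
    calc _ = P * P + Q * Q - P * Q - Q * P := by noncomm_ring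
      _ = _ := by rw [hP.1, hQ.1]
  have h2 : (P - Q * P) * (P - Q * P)ᵀ = P - P * Q - Q * P + Q * P * Q := by
    rw [transpose_sub, transpose_mul, hP.2, hQ.2]
    calc _ = P * P - (P * P) * Q - Q * (P * P) + Q * (P * P) * Q := by noncomm_ring
      _ = _ := by rw [hP.1]
  have h3 : (Q * P * Q).trace = (P * Q).trace := by
    rw [trace_mul_comm, ← Matrix.mul_assoc, hQ.1, trace_mul_comm]
  rw [h1, h2]
  simp only [trace_sub, trace_add, h3, trace_mul_comm Q P, hP.trace_eq_rank, hQ.trace_eq_rank, hr]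
  ring

lemma IsOrthProj.spec_one_sub_le [DecidableEq m] (hP : IsOrthProj P) : spec (1 - P) ≤ 1 := by
  refine spec_le zero_le_one fun x => ?_
  rw [sub_mulVec, one_mulVec, one_mul, ← sq_le_sq₀ (enorm_nonneg _) (enorm_nonneg _),
    hP.enorm_sub_sq]
  linarith [sq_nonneg (enorm (P *ᵥ x))]

end Projection

section Perturbation

variable {m n : Type*} [Fintype m] [Fintype n]

lemma IsMP.isOrthProj {A : Matrix m n ℝ} {X : Matrix n m ℝ} (h : IsMP A X) :
    IsOrthProj (A * X) :=
  ⟨by rw [← Matrix.mul_assoc, h.1], h.2.2.1⟩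

lemma IsMP.gap_eq [DecidableEq m] {A B : Matrix m n ℝ} {X Y : Matrix n m ℝ} (hB : IsMP B Y) :
    A * X - (B * Y) * (A * X) = (1 - B * Y) * ((A - B) * X) := by
  have h : (1 - B * Y) * B = 0 := by rw [Matrix.sub_mul, Matrix.one_mul, hB.1, sub_self]
  rw [Matrix.sub_mul A B X, Matrix.mul_sub, ← Matrix.mul_assoc _ B, h, Matrix.zero_mul, sub_zero,
    Matrix.sub_mul, Matrix.one_mul]

lemma IsMP.spec_sub_le {A B : Matrix m n ℝ} {X Y : Matrix n m ℝ} (hA : IsMP A X)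
    (hB : IsMP B Y) (hr : A.rank = B.rank) :
    spec (A * X - B * Y) ≤ spec (A - B) * spec X := by
  classical
  refine (hA.isOrthProj.spec_sub_le hB.isOrthProj (by rw [hA.rank_mul, hB.rank_mul, hr])).trans ?_
  rw [hB.gap_eq]
  calc _ ≤ spec (1 - B * Y) * spec ((A - B) * X) := spec_mul_le _ _
    _ ≤ 1 * spec ((A - B) * X) :=
      mul_le_mul_of_nonneg_right hB.isOrthProj.spec_one_sub_le (spec_nonneg _)
    _ ≤ _ := by
      rw [one_mul]
      exact spec_mul_le _ _

lemma IsMP.frob_sub_le {A B : Matrix m n ℝ} {X Y : Matrix n m ℝ} (hA : IsMP A X)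
    (hB : IsMP B Y) (hr : A.rank = B.rank) :
    frob (A * X - B * Y) ≤ Real.sqrt 2 * frob (A - B) * spec X := by
  classical
  rw [hA.isOrthProj.frob_sub hB.isOrthProj (by rw [hA.rank_mul, hB.rank_mul, hr]), hB.gap_eq,
    mul_assoc]
  refine mul_le_mul_of_nonneg_left ?_ (Real.sqrt_nonneg _)
  calc _ ≤ spec (1 - B * Y) * frob ((A - B) * X) := frob_mul_le' _ _
    _ ≤ 1 * frob ((A - B) * X) :=
      mul_le_mul_of_nonneg_right hB.isOrthProj.spec_one_sub_le (frob_nonneg _)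
    _ ≤ _ := by
      rw [one_mul]
      exact frob_mul_le _ _

end Perturbation

/-- **Projection perturbation lemma** (Lemma `LEM:Cai`): for rank-`r` matrices `A, B` of the
same size, `‖AA† − BB†‖₂ ≤ ‖A − B‖₂/σ_r(A)`, `‖A†A − B†B‖₂ ≤ ‖A − B‖₂/σ_r(A)`, and
`‖AA† − BB†‖_F ≤ √2‖A − B‖_F/σ_r(A)`, `‖A†A − B†B‖_F ≤ √2‖A − B‖_F/σ_r(A)`. -/
theorem projection_perturbation {m n : Type*} [Fintype m] [Fintype n] (r : ℕ)
    (A B : Matrix m n ℝ) (hA : A.rank = r) (hB : B.rank = r) :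
    spec (A * pinv A - B * pinv B) ≤ spec (A - B) / sval r A ∧
    spec (pinv A * A - pinv B * B) ≤ spec (A - B) / sval r A ∧
    frob (A * pinv A - B * pinv B) ≤ Real.sqrt 2 * frob (A - B) / sval r A ∧
    frob (pinv A * A - pinv B * B) ≤ Real.sqrt 2 * frob (A - B) / sval r A := by
  rcases Nat.eq_zero_or_pos r with rfl | hr
  · obtain rfl : A = 0 := eq_zero_of_rank_eq_zero hA
    obtain rfl : B = 0 := eq_zero_of_rank_eq_zero hB
    have hs : sval 0 (0 : Matrix m n ℝ) = 0 := by simp [sval]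
    have hm : spec (0 : Matrix m m ℝ) ≤ 0 := spec_le le_rfl fun x => by simp [enorm]
    have hn : spec (0 : Matrix n n ℝ) ≤ 0 := spec_le le_rfl fun x => by simp [enorm]
    simp [hs, hm, hn, frob]
  subst hA
  have hX := spec_pinv_le hr
  have hMA := isMP_pinv A
  have hMB := isMP_pinv B
  have hrT : Aᵀ.rank = Bᵀ.rank := by rw [rank_transpose, rank_transpose, hB]
  have hT : (pinv A * A - pinv B * B) = Aᵀ * (pinv A)ᵀ - Bᵀ * (pinv B)ᵀ := by
    rw [← transpose_mul, ← transpose_mul, hMA.2.2.2, hMB.2.2.2]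
  have hspec := mul_le_mul_of_nonneg_left hX (spec_nonneg (A - B))
  have hfrob := mul_le_mul_of_nonneg_left hX
    (mul_nonneg (Real.sqrt_nonneg 2) (frob_nonneg (A - B)))
  simp only [div_eq_mul_inv]
  refine ⟨(hMA.spec_sub_le hMB hB.symm).trans hspec, ?_,
    (hMA.frob_sub_le hMB hB.symm).trans hfrob, ?_⟩
  · rw [hT]
    refine (hMA.transpose.spec_sub_le hMB.transpose hrT).trans ?_
    rwa [← transpose_sub, spec_transpose, spec_transpose]
  · rw [hT]
    refine (hMA.transpose.frob_sub_le hMB.transpose hrT).trans ?_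
    rwa [← transpose_sub, frob_transpose, spec_transpose]

end TCUR
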